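/- arXiv:2111.12823 — 2 statements merged into one kernel-verified Lean document; each statement's English description precedes it below -/
import Mathlib

section
/- Let Σ ∈ ℝ^{k×k}, ρ ∈ ℝ^k, and σ² > 0 be such that both Σ and the block matrix M := [[Σ, ρ], [ρᵀ, σ²]] are symmetric positive definite, and let Δμ ∈ ℝ^k and Δv ∈ ℝ. For λ ∈ [0,1] set Λ(λ) := [[Σ, λρ], [λρᵀ, λ²σ² + (1−λ)²]], u(λ) := (Δμ, λΔv), and g(λ) := u(λ)ᵀ Λ(λ)⁻¹ u(λ). Then for every λ ∈ [0,1], Δμᵀ Σ⁻¹ Δμ ≤ g(λ) ≤ (Δμ, Δv)ᵀ M⁻¹ (Δμ, Δv). -/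
open MeasureTheory ProbabilityTheory Matrix

/-- The cumulative distribution function of the standard normal distribution. -/
noncomputable def stdNormalCDF (x : ℝ) : ℝ :=
  (ProbabilityTheory.gaussianReal 0 1 (Set.Iic x)).toReal

/-- The `(k+1)×(k+1)` block matrix `M = [[S, ρ], [ρᵀ, σsq]]`: the summed class-conditional
covariance matrix of the acquired features together with the (noiseless) auxiliary
feature `Z`. -/
def blockMat {k : ℕ} (S : Matrix (Fin k) (Fin k) ℝ) (ρ : Fin k → ℝ) (σsq : ℝ) :
    Matrix (Fin k ⊕ Fin 1) (Fin k ⊕ Fin 1) ℝ :=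
  Matrix.fromBlocks S (Matrix.of fun i _ => ρ i) (Matrix.of fun _ j => ρ j)
    (Matrix.of fun _ _ => σsq)

/-- The block matrix `Λ(λ) = [[S, λρ], [λρᵀ, λ²σsq + (1−λ)²]]`: the summed class-conditional
covariance matrix of the acquired features together with the noisy auxiliary feature
`Z_λ = λZ + (1−λ)N`. -/
def noisyMat {k : ℕ} (S : Matrix (Fin k) (Fin k) ℝ) (ρ : Fin k → ℝ) (σsq lam : ℝ) :
    Matrix (Fin k ⊕ Fin 1) (Fin k ⊕ Fin 1) ℝ :=
  Matrix.fromBlocks S (Matrix.of fun i _ => lam * ρ i) (Matrix.of fun _ j => lam * ρ j)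
    (Matrix.of fun _ _ => lam ^ 2 * σsq + (1 - lam) ^ 2)

/-- The vector `u(λ) = (Δμ, λΔv)`: the class-conditional mean difference of the acquired
features together with the noisy auxiliary feature `Z_λ`. -/
def noisyVec {k : ℕ} (Δμ : Fin k → ℝ) (Δv lam : ℝ) : Fin k ⊕ Fin 1 → ℝ :=
  Sum.elim Δμ fun _ => lam * Δv

/-- The quadratic form `g(λ) = u(λ)ᵀ Λ(λ)⁻¹ u(λ)`, whose value determines the best
generalized-linear-model AUC `Φ(√(g(λ)))` attainable with the noisy feature `Z_λ`. -/
noncomputable def noisyQuadForm {k : ℕ} (S : Matrix (Fin k) (Fin k) ℝ) (ρ : Fin k → ℝ)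
    (σsq : ℝ) (Δμ : Fin k → ℝ) (Δv lam : ℝ) : ℝ :=
  noisyVec Δμ Δv lam ⬝ᵥ (noisyMat S ρ σsq lam)⁻¹.mulVec (noisyVec Δμ Δv lam)

theorem det_blockMat {k : ℕ} {S : Matrix (Fin k) (Fin k) ℝ} (hS : IsUnit S.det)
    (ρ : Fin k → ℝ) (d : ℝ) :
    (blockMat S ρ d).det = S.det * (d - ρ ⬝ᵥ S⁻¹ *ᵥ ρ) := by
  have := S.invertibleOfIsUnitDet hS
  rw [blockMat, det_fromBlocks₁₁, det_fin_one, invOf_eq_nonsing_inv, Matrix.mul_assoc]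
  rfl

/-- Block inversion formula for the quadratic form of the inverse of `blockMat S ρ d`. -/
theorem dotProduct_inv_blockMat_mulVec {k : ℕ} {S : Matrix (Fin k) (Fin k) ℝ}
    (hS : IsUnit S.det) (hsymm : S.IsSymm) (ρ : Fin k → ℝ) {d : ℝ}
    (hd : d - ρ ⬝ᵥ S⁻¹ *ᵥ ρ ≠ 0) (m : Fin k → ℝ) (v : ℝ) :
    Sum.elim m (fun _ => v) ⬝ᵥ (blockMat S ρ d)⁻¹ *ᵥ (Sum.elim m fun _ => v) =
      m ⬝ᵥ S⁻¹ *ᵥ m + (v - ρ ⬝ᵥ S⁻¹ *ᵥ m) ^ 2 / (d - ρ ⬝ᵥ S⁻¹ *ᵥ ρ) := by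
  have hdet : IsUnit (blockMat S ρ d).det := by
    rw [det_blockMat hS]
    exact hS.mul hd.isUnit
  obtain ⟨t, ht⟩ : ∃ t, t = (v - ρ ⬝ᵥ S⁻¹ *ᵥ m) / (d - ρ ⬝ᵥ S⁻¹ *ᵥ ρ) := ⟨_, rfl⟩
  have ht' : t * (d - ρ ⬝ᵥ S⁻¹ *ᵥ ρ) = v - ρ ⬝ᵥ S⁻¹ *ᵥ m := by
    rw [ht, div_mul_cancel₀ _ hd]
  have hsol : blockMat S ρ d *ᵥ Sum.elim (S⁻¹ *ᵥ (m - t • ρ)) (fun _ => t) =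
      Sum.elim m fun _ => v := by
    rw [blockMat, fromBlocks_mulVec]
    congr 1
    · ext i
      simp [mulVec_mulVec, mul_nonsing_inv _ hS, mulVec, dotProduct, mul_comm]
    · ext i
      have h : (of fun _ j => ρ j : Matrix (Fin 1) (Fin k) ℝ) *ᵥ (S⁻¹ *ᵥ (m - t • ρ)) =
          fun _ => ρ ⬝ᵥ S⁻¹ *ᵥ (m - t • ρ) := rfl
      have h' : (of fun _ _ => d : Matrix (Fin 1) (Fin 1) ℝ) *ᵥ (fun _ => t) =
          fun _ => d * t := by
        ext j
        simp [mulVec, dotProduct]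
      simp only [Sum.elim_comp_inl, Sum.elim_comp_inr, Pi.add_apply, h, h']
      simp only [mulVec_sub, mulVec_smul, dotProduct_sub, dotProduct_smul, smul_eq_mul]
      linarith
  have hcomm : m ⬝ᵥ S⁻¹ *ᵥ ρ = ρ ⬝ᵥ S⁻¹ *ᵥ m := by
    rw [dotProduct_mulVec, ← mulVec_transpose, transpose_nonsing_inv, hsymm.eq, dotProduct_comm]
  rw [← hsol, mulVec_mulVec, nonsing_inv_mul _ hdet, one_mulVec, hsol,
    sumElim_dotProduct_sumElim]
  simp only [mulVec_sub, mulVec_smul, dotProduct_sub, dotProduct_smul, smul_eq_mul, hcomm]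
  simp only [dotProduct, Finset.univ_unique, Finset.sum_const, Finset.card_singleton, one_smul]
  simp only [dotProduct] at ht
  rw [ht]
  ring

theorem noisyMat_eq_blockMat {k : ℕ} (S : Matrix (Fin k) (Fin k) ℝ) (ρ : Fin k → ℝ)
    (σsq lam : ℝ) :
    noisyMat S ρ σsq lam = blockMat S (lam • ρ) (lam ^ 2 * σsq + (1 - lam) ^ 2) := rfl

/-- **Monotone range of the noisy quadratic form.** If `S` and `M = [[S, ρ], [ρᵀ, σsq]]`
are symmetric positive definite with `σsq > 0`, then for every `λ ∈ [0,1]`,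
`Δμᵀ S⁻¹ Δμ ≤ g(λ) ≤ (Δμ, Δv)ᵀ M⁻¹ (Δμ, Δv)`. -/
theorem noisyQuadForm_bounds
    {k : ℕ} (S : Matrix (Fin k) (Fin k) ℝ) (ρ : Fin k → ℝ) (σsq : ℝ) (hσ : 0 < σsq)
    (hS : S.PosDef) (hM : (blockMat S ρ σsq).PosDef) (Δμ : Fin k → ℝ) (Δv : ℝ) :
    ∀ lam ∈ Set.Icc (0 : ℝ) 1,
      Δμ ⬝ᵥ S⁻¹.mulVec Δμ ≤ noisyQuadForm S ρ σsq Δμ Δv lam ∧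
      noisyQuadForm S ρ σsq Δμ Δv lam
        ≤ Sum.elim Δμ (fun _ => Δv) ⬝ᵥ (blockMat S ρ σsq)⁻¹.mulVec (Sum.elim Δμ fun _ => Δv) := by
  intro lam _
  have hdet : IsUnit S.det := hS.det_pos.ne'.isUnit
  have hsymm : S.IsSymm := by simpa using hS.isHermitian
  have hs : 0 < σsq - ρ ⬝ᵥ S⁻¹ *ᵥ ρ := by
    have h := hM.det_pos
    rw [det_blockMat hdet] at h
    exact pos_of_mul_pos_right h hS.det_pos.le
  have hschur : lam ^ 2 * σsq + (1 - lam) ^ 2 - (lam • ρ) ⬝ᵥ S⁻¹ *ᵥ (lam • ρ) =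
      lam ^ 2 * (σsq - ρ ⬝ᵥ S⁻¹ *ᵥ ρ) + (1 - lam) ^ 2 := by
    simp only [mulVec_smul, dotProduct_smul, smul_dotProduct, smul_eq_mul]
    ring
  have hpos : 0 < lam ^ 2 * (σsq - ρ ⬝ᵥ S⁻¹ *ᵥ ρ) + (1 - lam) ^ 2 := by
    rcases eq_or_ne lam 0 with rfl | h
    · norm_num
    · positivity
  rw [noisyQuadForm, noisyMat_eq_blockMat, noisyVec,
    dotProduct_inv_blockMat_mulVec hdet hsymm _ (hschur ▸ hpos.ne'),
    dotProduct_inv_blockMat_mulVec hdet hsymm _ hs.ne', hschur, smul_dotProduct, smul_eq_mul,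
    ← mul_sub, mul_pow]
  refine ⟨le_add_of_nonneg_right (by positivity), ?_⟩
  gcongr _ + ?_
  rw [div_le_div_iff₀ hpos hs]
  nlinarith [mul_nonneg (sq_nonneg (Δv - ρ ⬝ᵥ S⁻¹ *ᵥ Δμ)) (sq_nonneg (1 - lam))]
end

section
/- Let Σ ∈ ℝ^{k×k}, ρ ∈ ℝ^k, and σ² > 0 be such that both Σ and the block matrix M := [[Σ, ρ], [ρᵀ, σ²]] are symmetric positive definite, and let Δμ ∈ ℝ^k and Δv ∈ ℝ. For λ ∈ [0,1] set Λ(λ) := [[Σ, λρ], [λρᵀ, λ²σ² + (1−λ)²]], u(λ) := (Δμ, λΔv), and g(λ) := u(λ)ᵀ Λ(λ)⁻¹ u(λ). Then for every real c with Φ(√(g(0))) ≤ c ≤ Φ(√(g(1))), there exists λ ∈ [0,1] such that Φ(√(g(λ))) = c. -/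
open MeasureTheory ProbabilityTheory Matrix

theorem continuous_stdNormalCDF : Continuous stdNormalCDF := by
  have hcdf : stdNormalCDF = cdf (gaussianReal 0 1) := by
    funext x
    rw [cdf_eq_real]
    rfl
  have : NullSingletonClass (gaussianReal 0 1) := nullSingletonClass_gaussianReal one_ne_zero
  rw [hcdf, continuous_iff_continuousAt]
  intro x
  have h := (cdf (gaussianReal 0 1)).measure_singleton x
  rw [measure_cdf, measure_singleton, eq_comm, ENNReal.ofReal_eq_zero, sub_nonpos] at h
  have hmono := monotone_cdf (gaussianReal 0 1)
  rw [hmono.continuousAt_iff_leftLim_eq_rightLim, StieltjesFunction.rightLim_eq]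
  exact le_antisymm (hmono.leftLim_le le_rfl) h

theorem det_noisyMat {k : ℕ} (S : Matrix (Fin k) (Fin k) ℝ) (ρ : Fin k → ℝ) (σsq lam : ℝ)
    (hS : IsUnit S.det) :
    (noisyMat S ρ σsq lam).det =
      lam ^ 2 * (blockMat S ρ σsq).det + (1 - lam) ^ 2 * S.det := by
  have := S.invertibleOfIsUnitDet hS
  rw [noisyMat, blockMat, det_fromBlocks₁₁, det_fromBlocks₁₁, det_fin_one, det_fin_one]
  simp only [Matrix.sub_apply, mul_apply, of_apply, Finset.sum_mul]
  have h : ∑ i, ∑ j, lam * ρ j * (⅟S) j i * (lam * ρ i) =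
      lam ^ 2 * ∑ i, ∑ j, ρ j * (⅟S) j i * ρ i := by
    simp only [Finset.mul_sum]
    exact Finset.sum_congr rfl fun i _ => Finset.sum_congr rfl fun j _ => by ring
  rw [h]
  ring

theorem det_noisyMat_pos {k : ℕ} {S : Matrix (Fin k) (Fin k) ℝ} {ρ : Fin k → ℝ} {σsq : ℝ}
    (hS : S.PosDef) (hM : (blockMat S ρ σsq).PosDef) (lam : ℝ) :
    0 < (noisyMat S ρ σsq lam).det := by
  have hS' := hS.det_pos
  have hM' := hM.det_pos
  rw [det_noisyMat S ρ σsq lam hS'.ne'.isUnit]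
  rcases eq_or_ne lam 0 with rfl | hlam
  · simpa using hS'
  · positivity

theorem continuous_noisyQuadForm {k : ℕ} {S : Matrix (Fin k) (Fin k) ℝ} {ρ : Fin k → ℝ}
    {σsq : ℝ} (hS : S.PosDef) (hM : (blockMat S ρ σsq).PosDef) (Δμ : Fin k → ℝ) (Δv : ℝ) :
    Continuous (noisyQuadForm S ρ σsq Δμ Δv) := by
  have hmat : Continuous (noisyMat S ρ σsq) := by
    refine Continuous.matrix_fromBlocks continuous_const ?_ ?_ ?_ <;>
      exact continuous_matrix fun i j => by simp only [of_apply]; fun_prop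
  have hvec : Continuous (noisyVec Δμ Δv) := by
    refine continuous_pi fun i => ?_
    rcases i with i | i <;> simp only [noisyVec, Sum.elim_inl, Sum.elim_inr] <;> fun_prop
  have hinv : Continuous fun lam => (noisyMat S ρ σsq lam)⁻¹ := by
    simp only [inv_def, Ring.inverse_eq_inv']
    exact (hmat.matrix_det.inv₀ fun lam => (det_noisyMat_pos hS hM lam).ne').smul
      hmat.matrix_adjugate
  exact hvec.dotProduct (hinv.matrix_mulVec hvec)


/-- **Intermediate value property of the noisy AUC.** If `S` and `M = [[S, ρ], [ρᵀ, σsq]]`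
are symmetric positive definite with `σsq > 0`, then every value `c` between
`Φ(√(g(0)))` and `Φ(√(g(1)))` is attained: there is `λ ∈ [0,1]` with `Φ(√(g(λ))) = c`. -/
theorem noisyAUC_intermediate_value
    {k : ℕ} (S : Matrix (Fin k) (Fin k) ℝ) (ρ : Fin k → ℝ) (σsq : ℝ) (hσ : 0 < σsq)
    (hS : S.PosDef) (hM : (blockMat S ρ σsq).PosDef) (Δμ : Fin k → ℝ) (Δv : ℝ) :
    ∀ c : ℝ, stdNormalCDF (Real.sqrt (noisyQuadForm S ρ σsq Δμ Δv 0)) ≤ c →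
      c ≤ stdNormalCDF (Real.sqrt (noisyQuadForm S ρ σsq Δμ Δv 1)) →
      ∃ lam ∈ Set.Icc (0 : ℝ) 1,
        stdNormalCDF (Real.sqrt (noisyQuadForm S ρ σsq Δμ Δv lam)) = c := by
  intro c h0 h1
  have hcont : Continuous fun lam =>
      stdNormalCDF (Real.sqrt (noisyQuadForm S ρ σsq Δμ Δv lam)) :=
    continuous_stdNormalCDF.comp (continuous_noisyQuadForm hS hM Δμ Δv).sqrt
  exact intermediate_value_Icc zero_le_one hcont.continuousOn ⟨h0, h1⟩
end
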